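/- Let Ψ be a planar-monotone-style CNF instance with n variables and m clauses, and let G_Ψ be the associated domination graph. If S is a dominating set of G_Ψ with cardinality exactly n, then for every variable i the intersection of S with the four-element set {v_i, v̄_i, u_i, w_i} has exactly one element. -/

import Mathlib

/-- A planar-monotone-style CNF instance with `n` variables and `m` clauses:
clause `h` consists of the set of variable indices `L h` together with a sign
`eps h` (`true` = all literals unnegated, `false` = all negated). -/
structure PMCnf (n m : ℕ) where
  L : Fin m → Finset (Fin n)
  eps : Fin m → Bool

/-- An assignment `a` satisfies `Ψ` if every clause contains a variable whose
value agrees with the sign of the clause. -/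
def PMCnf.Satisfies {n m : ℕ} (Ψ : PMCnf n m) (a : Fin n → Bool) : Prop :=
  ∀ h : Fin m, ∃ i ∈ Ψ.L h, a i = Ψ.eps h

/-- The closed neighborhood `Γ(S)` of a set of vertices. -/
def closedNbhd {V : Type*} (G : SimpleGraph V) (S : Set V) : Set V :=
  S ∪ {v | ∃ s ∈ S, G.Adj v s}

/-- `S` is a dominating set if `Γ(S) = V`. -/
def IsDominating {V : Type*} (G : SimpleGraph V) (S : Set V) : Prop :=
  closedNbhd G S = Set.univ

/-- Vertices of the domination graph `G_Ψ`: for each variable `i` the four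
vertices `v_i = (i,0)`, `v̄_i = (i,1)`, `u_i = (i,2)`, `w_i = (i,3)`, and for
each clause `h` a vertex `z_h`. -/
abbrev DomVert (n m : ℕ) := (Fin n × Fin 4) ⊕ Fin m

/-- The base relation generating the edges of `G_Ψ`: the four vertices of each
variable gadget are pairwise adjacent, and `z_h` is adjacent to `v_i`
(resp. `v̄_i`) for each `i ∈ L h` when `eps h` is `true` (resp. `false`). -/
def domRel {n m : ℕ} (Ψ : PMCnf n m) : DomVert n m → DomVert n m → Prop
  | Sum.inl (i, _), Sum.inl (j, _) => i = j
  | Sum.inl (i, a), Sum.inr h => i ∈ Ψ.L h ∧ a = (if Ψ.eps h then 0 else 1)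
  | Sum.inr h, Sum.inl (i, a) => i ∈ Ψ.L h ∧ a = (if Ψ.eps h then 0 else 1)
  | Sum.inr _, Sum.inr _ => False

/-- The domination graph `G_Ψ` associated to the CNF instance `Ψ`. -/
def domGraph {n m : ℕ} (Ψ : PMCnf n m) : SimpleGraph (DomVert n m) :=
  SimpleGraph.fromRel (domRel Ψ)

/-- A dominating set of `G_Ψ` meets every variable gadget. -/
theorem IsDominating.exists_mem_gadget {n m : ℕ} {Ψ : PMCnf n m} {S : Set (DomVert n m)}
    (hS : IsDominating (domGraph Ψ) S) (i : Fin n) : ∃ c : Fin 4, Sum.inl (i, c) ∈ S := by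
  have hu : (Sum.inl (i, 2) : DomVert n m) ∈ closedNbhd (domGraph Ψ) S := by
    rw [hS]
    trivial
  rcases hu with hu | ⟨⟨j, c⟩ | h, hs, hadj⟩
  · exact ⟨2, hu⟩
  · have hij : i = j := by
      rcases ((SimpleGraph.fromRel_adj _ _ _).1 hadj).2 with h | h
      exacts [h, Eq.symm h]
    exact ⟨c, hij ▸ hs⟩
  · rcases ((SimpleGraph.fromRel_adj _ _ _).1 hadj).2 with ⟨-, h⟩ | ⟨-, h⟩ <;>
      split_ifs at h <;> simp at h

/-- If `S` is a dominating set of `G_Ψ` of cardinality exactly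
`n`, then `S` meets each variable gadget `{v_i, v̄_i, u_i, w_i}` in exactly one
element. -/
theorem domGraph_dominating_inter_gadget {n m : ℕ} (Ψ : PMCnf n m)
    (S : Set (DomVert n m)) (hS : IsDominating (domGraph Ψ) S)
    (hcard : S.ncard = n) :
    ∀ i : Fin n,
      (S ∩ {x : DomVert n m | ∃ c : Fin 4, x = Sum.inl (i, c)}).ncard = 1 := by
  choose c hc using hS.exists_mem_gadget
  let f : Fin n → DomVert n m := fun i => Sum.inl (i, c i)
  have hf : Function.Injective f := fun i j h => congrArg Prod.fst (Sum.inl_injective h)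
  have hrange : Set.range f = S := by
    refine Set.eq_of_subset_of_ncard_le (Set.range_subset_iff.2 hc) ?_ S.toFinite
    rw [hcard, Set.ncard_range_of_injective hf, Nat.card_fin]
  intro i
  refine Set.ncard_eq_one.2 ⟨f i, Set.Subset.antisymm ?_ ?_⟩
  · rintro x ⟨hx, d, rfl⟩
    obtain ⟨j, hj⟩ := hrange ▸ hx
    obtain rfl : j = i := congrArg Prod.fst (Sum.inl_injective hj)
    exact hj.symm
  · rintro _ rfl
    exact ⟨hc i, c i, rfl⟩
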